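/- arXiv:2411.15956 — 2 statements merged into one kernel-verified Lean document; each statement's English description precedes it below -/
import Mathlib

section
/- Let γ ∈ Mat_{n+4}(ℝ) satisfy γᵗS₁γ = S₁, and write the (n+3)-rd row of γ as lᵗ = (l₁, l₂, xᵗ, l_{n+3}, l_{n+4}) and the (n+4)-th row as mᵗ = (m₁, m₂, yᵗ, m_{n+3}, m_{n+4}) with x, y ∈ ℝⁿ. Let ℓ = S₁⁻¹·(m | l) ∈ Mat_{n+4,2}(ℝ), so explicitly ℓ has columns (m_{n+4}, m_{n+3}, −(S⁻¹y)ᵗ, m₂, m₁)ᵗ and (l_{n+4}, l_{n+3}, −(S⁻¹x)ᵗ, l₂, l₁)ᵗ. Then: (a) det(ℓᵗR_Iℓ) = ((l₂+l_{n+3})(m₁+m_{n+4}) − (l₁+l_{n+4})(m₂+m_{n+3}))². (b) Moreover, write γ in block form [[α, aᵗ, β],[b, A, c],[γ₀, dᵗ, δ]] (scalar corners, b, c ∈ ℝ^{n+2}, A ∈ Mat_{n+2}(ℝ)), let I = (i, 0, …, 0, i)ᵗ ∈ ℂ^{n+2}, set j(γ, I) := −(1/2)(IᵗS₀I)γ₀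 + dᵗI + δ = (m₁+m_{n+4}) + i(m₂+m_{n+3}), and assume j(γ, I) ≠ 0; define γ⟨I⟩ := (−(1/2)(IᵗS₀I)·b + A·I + c)/j(γ, I) ∈ ℂ^{n+2} and let (γ⟨I⟩)₂ denote its last coordinate. Then Im((γ⟨I⟩)₂) / Q₀[Im(γ⟨I⟩)] = (l₂+l_{n+3})(m₁+m_{n+4}) − (l₁+l_{n+4})(m₂+m_{n+3}), where Q₀[v] := vᵗQ₀v for v ∈ ℝ^{n+2}; in particular (Im((γ⟨I⟩)₂) / Q₀[Im(γ⟨I⟩)])² = det(R_I[ℓ]). -/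
open Matrix

noncomputable section

/-- Border an `m×m` matrix `A` to the `(m+2)×(m+2)` matrix `[[0,0,1],[0,A,0],[1,0,0]]`
(block sizes `1, m, 1`). -/
def triBorder {α : Type*} [Zero α] [One α] {m : ℕ} (A : Matrix (Fin m) (Fin m) α) :
    Matrix (Fin (m + 2)) (Fin (m + 2)) α :=
  Matrix.of fun i j =>
    if hij : 0 < i.val ∧ i.val < m + 1 ∧ 0 < j.val ∧ j.val < m + 1 then
      A ⟨i.val - 1, by omega⟩ ⟨j.val - 1, by omega⟩
    else if (i.val = 0 ∧ j.val = m + 1) ∨ (i.val = m + 1 ∧ j.val = 0) then 1 else 0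

/-- `S₀ = [[0,0,1],[0,−S,0],[1,0,0]] ∈ Mat_{n+2}(ℝ)` (block sizes `1, n, 1`). -/
def matS0 (n : ℕ) (S : Matrix (Fin n) (Fin n) ℝ) : Matrix (Fin (n + 2)) (Fin (n + 2)) ℝ :=
  triBorder (-S)

/-- `S₁ = [[0,0,1],[0,S₀,0],[1,0,0]] ∈ Mat_{n+4}(ℝ)` (block sizes `1, n+2, 1`). -/
def matS1 (n : ℕ) (S : Matrix (Fin n) (Fin n) ℝ) : Matrix (Fin (n + 4)) (Fin (n + 4)) ℝ :=
  triBorder (matS0 n S)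

/-- `R_I = diag(1, 1, S, 1, 1) ∈ Mat_{n+4}(ℝ)`. -/
def matRI (n : ℕ) (S : Matrix (Fin n) (Fin n) ℝ) : Matrix (Fin (n + 4)) (Fin (n + 4)) ℝ :=
  Matrix.of fun i j =>
    if hij : 2 ≤ i.val ∧ i.val < n + 2 ∧ 2 ≤ j.val ∧ j.val < n + 2 then
      S ⟨i.val - 2, by omega⟩ ⟨j.val - 2, by omega⟩
    else if i = j then 1 else 0

/-- The matrix `ℓ = S₁⁻¹·(m | l)`, where `lᵗ` and `mᵗ` are the `(n+3)`-rd and `(n+4)`-th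
rows of `γ`. -/
def colIso (n : ℕ) (S : Matrix (Fin n) (Fin n) ℝ)
    (γ : Matrix (Fin (n + 4)) (Fin (n + 4)) ℝ) : Matrix (Fin (n + 4)) (Fin 2) ℝ :=
  Matrix.of fun i j =>
    if j = 0 then ((matS1 n S)⁻¹ *ᵥ γ ⟨n + 3, by omega⟩) i
    else ((matS1 n S)⁻¹ *ᵥ γ ⟨n + 2, by omega⟩) i

/-- The point `I = (i, 0, …, 0, i)ᵗ ∈ ℂ^{n+2}` of the tube domain. -/
def tubeI (n : ℕ) : Fin (n + 2) → ℂ := fun k =>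
  if k.val = 0 ∨ k.val = n + 1 then Complex.I else 0

/-- The quadratic expression `Iᵗ S₀ I ∈ ℂ` (which equals `−2`). -/
def quadI (n : ℕ) (S : Matrix (Fin n) (Fin n) ℝ) : ℂ :=
  ∑ a : Fin (n + 2), ∑ b : Fin (n + 2),
    tubeI n a * ((matS0 n S a b : ℝ) : ℂ) * tubeI n b

/-- The factor of automorphy `j(γ, I) = −(1/2)(Iᵗ S₀ I)·γ₀ + dᵗI + δ`, where the bottom
row of `γ` is `(γ₀, dᵗ, δ)`. -/
def jFactor (n : ℕ) (S : Matrix (Fin n) (Fin n) ℝ)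
    (γ : Matrix (Fin (n + 4)) (Fin (n + 4)) ℝ) : ℂ :=
  -(1 / 2) * quadI n S * ((γ ⟨n + 3, by omega⟩ 0 : ℝ) : ℂ) +
    (∑ k : Fin (n + 2), ((γ ⟨n + 3, by omega⟩ k.succ.castSucc : ℝ) : ℂ) * tubeI n k) +
    ((γ ⟨n + 3, by omega⟩ ⟨n + 3, by omega⟩ : ℝ) : ℂ)

/-- The point `γ⟨I⟩ = (−(1/2)(IᵗS₀I)·b + A·I + c)/j(γ, I) ∈ ℂ^{n+2}`, where `γ` has
block form `[[α, aᵗ, β],[b, A, c],[γ₀, dᵗ, δ]]`. -/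
def actI (n : ℕ) (S : Matrix (Fin n) (Fin n) ℝ)
    (γ : Matrix (Fin (n + 4)) (Fin (n + 4)) ℝ) : Fin (n + 2) → ℂ := fun k =>
  (-(1 / 2) * quadI n S * ((γ k.succ.castSucc 0 : ℝ) : ℂ) +
      (∑ k' : Fin (n + 2), ((γ k.succ.castSucc k'.succ.castSucc : ℝ) : ℂ) * tubeI n k') +
      ((γ k.succ.castSucc ⟨n + 3, by omega⟩ : ℝ) : ℂ)) / jFactor n S γ

theorem Fin.sum_univ_border {M : Type*} [AddCommMonoid M] {k : ℕ} (f : Fin (k + 2) → M) :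
    ∑ i, f i = f 0 + ∑ i : Fin k, f i.castSucc.succ + f (Fin.last (k + 1)) := by
  rw [Fin.sum_univ_castSucc, Fin.sum_univ_succ]
  rfl

theorem Fin.border_cases {k : ℕ} {P : Fin (k + 2) → Prop} (zero : P 0)
    (mid : ∀ i : Fin k, P i.castSucc.succ) (last : P (Fin.last (k + 1))) (i : Fin (k + 2)) :
    P i :=
  Fin.lastCases last (Fin.cases (by simpa using zero) mid) i

section triBorder

variable {α : Type*} {k : ℕ}

section entries

variable [Zero α] [One α] (A : Matrix (Fin k) (Fin k) α)

@[simp] theorem triBorder_zero_zero : triBorder A 0 0 = 0 := by simp [triBorder]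

@[simp] theorem triBorder_zero_mid (j : Fin k) : triBorder A 0 j.castSucc.succ = 0 := by
  simp [triBorder, j.isLt.ne]

@[simp] theorem triBorder_zero_last : triBorder A 0 (Fin.last (k + 1)) = 1 := by
  simp [triBorder]

@[simp] theorem triBorder_mid_zero (i : Fin k) : triBorder A i.castSucc.succ 0 = 0 := by
  simp [triBorder, i.isLt.ne]

@[simp] theorem triBorder_mid_mid (i j : Fin k) :
    triBorder A i.castSucc.succ j.castSucc.succ = A i j := by simp [triBorder]

@[simp] theorem triBorder_mid_last (i : Fin k) :
    triBorder A i.castSucc.succ (Fin.last (k + 1)) = 0 := by simp [triBorder]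

@[simp] theorem triBorder_last_zero : triBorder A (Fin.last (k + 1)) 0 = 1 := by
  simp [triBorder]

@[simp] theorem triBorder_last_mid (j : Fin k) :
    triBorder A (Fin.last (k + 1)) j.castSucc.succ = 0 := by simp [triBorder]

@[simp] theorem triBorder_last_last :
    triBorder A (Fin.last (k + 1)) (Fin.last (k + 1)) = 0 := by simp [triBorder]

theorem Matrix.IsSymm.triBorder {A : Matrix (Fin k) (Fin k) α} (hA : A.IsSymm) :
    (triBorder A).IsSymm := by
  ext i j
  induction i using Fin.border_cases <;> induction j using Fin.border_cases <;>
    simp [hA.apply]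

end entries

variable [CommRing α]

theorem triBorder_mul_triBorder_eq_one {A B : Matrix (Fin k) (Fin k) α} (h : A * B = 1) :
    triBorder A * triBorder B = 1 := by
  ext i j
  have hAB (i j : Fin k) : ∑ x, A i x * B x j = (1 : Matrix (Fin k) (Fin k) α) i j := by
    rw [← h, Matrix.mul_apply]
  rw [Matrix.mul_apply, Fin.sum_univ_border]
  induction i using Fin.border_cases <;> induction j using Fin.border_cases <;>
    simp [hAB, Matrix.one_apply, Fin.ext_iff] <;> omega

theorem dotProduct_triBorder_mulVec (A : Matrix (Fin k) (Fin k) α) (u w : Fin (k + 2) → α) :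
    u ⬝ᵥ triBorder A *ᵥ w = u 0 * w (Fin.last (k + 1)) + u (Fin.last (k + 1)) * w 0 +
      (fun i : Fin k => u i.castSucc.succ) ⬝ᵥ A *ᵥ fun i : Fin k => w i.castSucc.succ := by
  simp only [dotProduct, mulVec, Fin.sum_univ_border, triBorder_zero_zero, triBorder_zero_mid,
    triBorder_zero_last, triBorder_mid_zero, triBorder_mid_mid, triBorder_mid_last,
    triBorder_last_zero, triBorder_last_mid, triBorder_last_last]
  simp
  ring

end triBorder

/-- The vector `(1, 0, …, 0, 1)`, the real part of `(1, I, 1)`. -/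
def outerVec (n : ℕ) : Fin (n + 4) → ℝ :=
  Pi.single 0 1 + Pi.single (Fin.last (n + 3)) 1

/-- The vector `(0, 1, 0, …, 0, 1, 0)`, the imaginary part of `(1, I, 1)`. -/
def innerVec (n : ℕ) : Fin (n + 4) → ℝ :=
  Pi.single 1 1 + Pi.single ⟨n + 2, by omega⟩ 1

theorem dotProduct_outerVec {n : ℕ} (u : Fin (n + 4) → ℝ) :
    u ⬝ᵥ outerVec n = u 0 + u ⟨n + 3, by omega⟩ := by
  simp [outerVec, dotProduct_add, Fin.last]

theorem dotProduct_innerVec {n : ℕ} (u : Fin (n + 4) → ℝ) :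
    u ⬝ᵥ innerVec n = u 1 + u ⟨n + 2, by omega⟩ := by
  simp [innerVec, dotProduct_add]

section forms

variable {n : ℕ} {S : Matrix (Fin n) (Fin n) ℝ}

theorem matS1_isSymm (hS : S.IsSymm) : (matS1 n S).IsSymm :=
  hS.neg.triBorder.triBorder

theorem matS1_mul_triBorder_inv (hS : IsUnit S.det) :
    matS1 n S * triBorder (triBorder (-S⁻¹)) = 1 :=
  triBorder_mul_triBorder_eq_one <| triBorder_mul_triBorder_eq_one <| by
    rw [neg_mul_neg, Matrix.mul_nonsing_inv _ hS]

theorem matRI_add_matS1 : matRI n S + matS1 n S =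
    vecMulVec (outerVec n) (outerVec n) + vecMulVec (innerVec n) (innerVec n) := by
  ext ⟨i, hi⟩ ⟨j, hj⟩
  simp only [matRI, matS1, matS0, triBorder, vecMulVec, outerVec, innerVec, Matrix.add_apply,
    Matrix.of_apply, Pi.add_apply, Pi.single_apply, Fin.ext_iff, Fin.val_zero, Fin.val_one,
    Fin.val_last, Matrix.neg_apply, Nat.sub_sub]
  grind (splits := 20)

theorem matS1_mulVec_outerVec : matS1 n S *ᵥ outerVec n = outerVec n := by
  ext i
  change matS1 n S i ⬝ᵥ _ = _
  rw [dotProduct_outerVec]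
  simp only [matS1, matS0, triBorder, outerVec, Matrix.of_apply, Pi.add_apply, Pi.single_apply,
    Fin.ext_iff, Fin.val_zero, Fin.val_last]
  grind

theorem matS1_mulVec_innerVec : matS1 n S *ᵥ innerVec n = innerVec n := by
  ext i
  change matS1 n S i ⬝ᵥ _ = _
  rw [dotProduct_innerVec]
  simp only [matS1, matS0, triBorder, innerVec, Matrix.of_apply, Pi.add_apply, Pi.single_apply,
    Fin.ext_iff, Fin.val_one]
  grind

theorem quadI_eq : quadI n S = -2 := by
  have hmid (k : Fin n) : tubeI n k.castSucc.succ = 0 := by simp [tubeI, k.isLt.ne]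
  have hzero : tubeI n 0 = Complex.I := by simp [tubeI]
  have hlast : tubeI n (Fin.last (n + 1)) = Complex.I := by simp [tubeI]
  simp only [quadI, Fin.sum_univ_border, hmid, hzero, hlast, matS0, triBorder_zero_zero,
    triBorder_zero_last, triBorder_last_zero, triBorder_last_last]
  simp
  norm_num

/-- A row of `γ` applied to the isotropic vector `(1, I, 1)`. -/
theorem row_apply_base_point (u : Fin (n + 4) → ℝ) :
    -(1 / 2) * quadI n S * ((u 0 : ℝ) : ℂ) +
      (∑ k : Fin (n + 2), ((u k.succ.castSucc : ℝ) : ℂ) * tubeI n k) +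
      ((u ⟨n + 3, by omega⟩ : ℝ) : ℂ) =
    ((u ⬝ᵥ outerVec n : ℝ) : ℂ) + Complex.I * ((u ⬝ᵥ innerVec n : ℝ) : ℂ) := by
  have hmid (k : Fin n) : tubeI n k.castSucc.succ = 0 := by simp [tubeI, k.isLt.ne]
  have hzero : tubeI n 0 = Complex.I := by simp [tubeI]
  have hlast : tubeI n (Fin.last (n + 1)) = Complex.I := by simp [tubeI]
  have h1 : (Fin.succ 0 : Fin (n + 3)).castSucc = 1 := rfl
  have h2 : (Fin.last (n + 1)).succ.castSucc = (⟨n + 2, by omega⟩ : Fin (n + 4)) := rfl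
  rw [quadI_eq, dotProduct_outerVec, dotProduct_innerVec, Fin.sum_univ_border, h1, h2]
  simp only [hmid, hzero, hlast]
  push_cast
  simp
  ring

theorem jFactor_eq (γ : Matrix (Fin (n + 4)) (Fin (n + 4)) ℝ) :
    jFactor n S γ = (((γ *ᵥ outerVec n) (Fin.last (n + 3)) : ℝ) : ℂ) +
      Complex.I * (((γ *ᵥ innerVec n) (Fin.last (n + 3)) : ℝ) : ℂ) :=
  row_apply_base_point (γ (Fin.last (n + 3)))

theorem actI_eq (γ : Matrix (Fin (n + 4)) (Fin (n + 4)) ℝ) (k : Fin (n + 2)) :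
    actI n S γ k = ((((γ *ᵥ outerVec n) k.castSucc.succ : ℝ) : ℂ) +
      Complex.I * (((γ *ᵥ innerVec n) k.castSucc.succ : ℝ) : ℂ)) / jFactor n S γ :=
  congrArg (· / jFactor n S γ) (row_apply_base_point (γ k.castSucc.succ))

theorem Complex.im_ofReal_add_I_mul_div (a b p q : ℝ) :
    (((a : ℂ) + Complex.I * b) / ((p : ℂ) + Complex.I * q)).im =
      (b * p - a * q) / (p ^ 2 + q ^ 2) := by
  simp [Complex.div_im, Complex.normSq_apply]
  ring

variable {γ : Matrix (Fin (n + 4)) (Fin (n + 4)) ℝ}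

theorem mulVec_dotProduct_matS1_mulVec (hγ : γᵀ * matS1 n S * γ = matS1 n S)
    (u w : Fin (n + 4) → ℝ) :
    (γ *ᵥ u) ⬝ᵥ matS1 n S *ᵥ (γ *ᵥ w) = u ⬝ᵥ matS1 n S *ᵥ w := by
  conv_rhs => rw [← hγ]
  rw [← Matrix.mulVec_mulVec, ← Matrix.mulVec_mulVec, Matrix.dotProduct_mulVec u,
    Matrix.vecMul_transpose]

/-- The imaginary part of `γ⟨I⟩` has norm `Q₀[Im γ⟨I⟩] = |j(γ, I)|⁻²`. -/
theorem Q0_im_actI (hS : S.IsSymm) (hγ : γᵀ * matS1 n S * γ = matS1 n S) {p q : ℝ}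
    (hp : (γ *ᵥ outerVec n) (Fin.last (n + 3)) = p)
    (hq : (γ *ᵥ innerVec n) (Fin.last (n + 3)) = q) (hpq : p ^ 2 + q ^ 2 ≠ 0) :
    (fun k => (actI n S γ k).im) ⬝ᵥ (((1 : ℝ) / 2) • matS0 n S *ᵥ
      fun k => (actI n S γ k).im) = 1 / (p ^ 2 + q ^ 2) := by
  have haa := mulVec_dotProduct_matS1_mulVec hγ (outerVec n) (outerVec n)
  have hab := mulVec_dotProduct_matS1_mulVec hγ (outerVec n) (innerVec n)
  have hbb := mulVec_dotProduct_matS1_mulVec hγ (innerVec n) (innerVec n)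
  rw [matS1_mulVec_outerVec, dotProduct_outerVec] at haa
  rw [matS1_mulVec_innerVec, dotProduct_innerVec] at hab hbb
  rw [matS1, dotProduct_triBorder_mulVec, hp] at haa
  rw [matS1, dotProduct_triBorder_mulVec, hp, hq] at hab
  rw [matS1, dotProduct_triBorder_mulVec, hq] at hbb
  set a : Fin (n + 2) → ℝ := fun k => (γ *ᵥ outerVec n) k.castSucc.succ with ha
  set b : Fin (n + 2) → ℝ := fun k => (γ *ᵥ innerVec n) k.castSucc.succ with hb
  have hsymm : b ⬝ᵥ matS0 n S *ᵥ a = a ⬝ᵥ matS0 n S *ᵥ b := by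
    have h : (matS0 n S)ᵀ = matS0 n S := hS.neg.triBorder
    rw [Matrix.dotProduct_mulVec, ← Matrix.mulVec_transpose, h, dotProduct_comm]
  have him : (fun k => (actI n S γ k).im) = (p ^ 2 + q ^ 2)⁻¹ • (p • b - q • a) := by
    ext k
    rw [actI_eq, jFactor_eq, hp, hq, Complex.im_ofReal_add_I_mul_div]
    simp [ha, hb]
    ring
  have hoo : outerVec n 0 + outerVec n ⟨n + 3, by omega⟩ = 2 := by
    simp [outerVec, Pi.single_apply, Fin.ext_iff]; norm_num
  have hoi : outerVec n 1 + outerVec n ⟨n + 2, by omega⟩ = 0 := by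
    simp [outerVec, Fin.ext_iff]
  have hii : innerVec n 1 + innerVec n ⟨n + 2, by omega⟩ = 2 := by
    simp [innerVec, Fin.ext_iff]; norm_num
  rw [hoo] at haa
  rw [hoi] at hab
  rw [hii] at hbb
  rw [him]
  simp only [Matrix.mulVec_smul, Matrix.mulVec_sub, dotProduct_smul, smul_dotProduct,
    dotProduct_sub, sub_dotProduct, smul_eq_mul, hsymm]
  field_simp
  linear_combination q ^ 2 * haa - 2 * p * q * hab + p ^ 2 * hbb

theorem mul_inv_matS1_mul_transpose (hS : IsUnit S.det)
    (hγ : γᵀ * matS1 n S * γ = matS1 n S) :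
    γ * (matS1 n S)⁻¹ * γᵀ = (matS1 n S)⁻¹ := by
  have hdet : IsUnit (matS1 n S).det :=
    Matrix.isUnit_det_of_right_inverse (matS1_mul_triBorder_inv hS)
  have h : ((matS1 n S)⁻¹ * γᵀ * matS1 n S) * γ = 1 := by
    rw [Matrix.mul_assoc, Matrix.mul_assoc, ← Matrix.mul_assoc γᵀ, hγ,
      Matrix.nonsing_inv_mul _ hdet]
  rw [mul_eq_one_comm] at h
  refine (Matrix.inv_eq_left_inv ?_).symm
  simpa only [Matrix.mul_assoc] using h

/-- The Gram matrix of the rows of `γ` with respect to `S₁⁻¹` is `S₁⁻¹` itself. -/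
theorem row_dotProduct_inv_matS1_mulVec_row (hS : IsUnit S.det)
    (hγ : γᵀ * matS1 n S * γ = matS1 n S) (i j : Fin (n + 4)) :
    γ i ⬝ᵥ (matS1 n S)⁻¹ *ᵥ γ j = triBorder (triBorder (-S⁻¹)) i j := by
  rw [← Matrix.inv_eq_right_inv (matS1_mul_triBorder_inv hS), Matrix.dotProduct_mulVec]
  exact congrFun (congrFun (mul_inv_matS1_mul_transpose hS hγ) i) j

/-- On vectors `S₁⁻¹u`, `S₁⁻¹w`, the majorant `R_I` differs from `-S₁` by the rank two form
spanned by `outerVec` and `innerVec`. -/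
theorem inv_mulVec_dotProduct_matRI_mulVec (hS : S.IsSymm) (hdet : IsUnit S.det)
    (u w : Fin (n + 4) → ℝ) :
    ((matS1 n S)⁻¹ *ᵥ u) ⬝ᵥ matRI n S *ᵥ ((matS1 n S)⁻¹ *ᵥ w) =
      (u ⬝ᵥ outerVec n) * (w ⬝ᵥ outerVec n) + (u ⬝ᵥ innerVec n) * (w ⬝ᵥ innerVec n) -
        u ⬝ᵥ (matS1 n S)⁻¹ *ᵥ w := by
  have hdet' : IsUnit (matS1 n S).det :=
    Matrix.isUnit_det_of_right_inverse (matS1_mul_triBorder_inv hdet)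
  have hT : ((matS1 n S)⁻¹)ᵀ = (matS1 n S)⁻¹ := by
    rw [Matrix.transpose_nonsing_inv, matS1_isSymm hS]
  have hadj (x y : Fin (n + 4) → ℝ) :
      ((matS1 n S)⁻¹ *ᵥ x) ⬝ᵥ y = x ⬝ᵥ (matS1 n S)⁻¹ *ᵥ y := by
    rw [Matrix.dotProduct_mulVec, ← Matrix.mulVec_transpose, hT]
  have hfix {x : Fin (n + 4) → ℝ} (hx : matS1 n S *ᵥ x = x) : (matS1 n S)⁻¹ *ᵥ x = x := by
    conv_lhs => rw [← hx]
    rw [Matrix.mulVec_mulVec, Matrix.nonsing_inv_mul _ hdet', Matrix.one_mulVec]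
  have hR := eq_sub_of_add_eq (matRI_add_matS1 (n := n) (S := S))
  have ho (x : Fin (n + 4) → ℝ) :
      ((matS1 n S)⁻¹ *ᵥ x) ⬝ᵥ outerVec n = x ⬝ᵥ outerVec n := by
    rw [hadj, hfix matS1_mulVec_outerVec]
  have hi (x : Fin (n + 4) → ℝ) :
      ((matS1 n S)⁻¹ *ᵥ x) ⬝ᵥ innerVec n = x ⬝ᵥ innerVec n := by
    rw [hadj, hfix matS1_mulVec_innerVec]
  rw [hR, Matrix.sub_mulVec, Matrix.add_mulVec, dotProduct_sub, dotProduct_add,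
    Matrix.mulVec_mulVec _ (matS1 n S), Matrix.mul_nonsing_inv _ hdet', Matrix.one_mulVec, hadj u w,
    Matrix.vecMulVec_mulVec, Matrix.vecMulVec_mulVec]
  simp only [dotProduct_smul, op_smul_eq_smul, smul_eq_mul, ho, hi,
    dotProduct_comm (outerVec n), dotProduct_comm (innerVec n)]
  ring

theorem det_colIso_gram (hS : S.IsSymm) (hdet : IsUnit S.det)
    (hγ : γᵀ * matS1 n S * γ = matS1 n S) :
    ((colIso n S γ)ᵀ * matRI n S * colIso n S γ).det =
      ((γ ⟨n + 2, by omega⟩ ⬝ᵥ innerVec n) * (γ ⟨n + 3, by omega⟩ ⬝ᵥ outerVec n) -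
        (γ ⟨n + 2, by omega⟩ ⬝ᵥ outerVec n) * (γ ⟨n + 3, by omega⟩ ⬝ᵥ innerVec n)) ^ 2 := by
  let r : Fin 2 → Fin (n + 4) := ![⟨n + 3, by omega⟩, ⟨n + 2, by omega⟩]
  have hcol (i : Fin 2) : (colIso n S γ).col i = (matS1 n S)⁻¹ *ᵥ γ (r i) := by
    ext k
    fin_cases i <;> simp [colIso, r]
  have hiso (i j : Fin 2) : triBorder (triBorder (-S⁻¹)) (r i) (r j) = 0 := by
    fin_cases i <;> fin_cases j <;> simp [r, triBorder]
  have hentry (i j : Fin 2) : ((colIso n S γ)ᵀ * matRI n S * colIso n S γ) i j =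
      (γ (r i) ⬝ᵥ outerVec n) * (γ (r j) ⬝ᵥ outerVec n) +
        (γ (r i) ⬝ᵥ innerVec n) * (γ (r j) ⬝ᵥ innerVec n) := by
    have h : ((colIso n S γ)ᵀ * matRI n S * colIso n S γ) i j =
        (colIso n S γ).col i ⬝ᵥ matRI n S *ᵥ (colIso n S γ).col j := by
      rw [Matrix.mul_assoc]
      rfl
    rw [h, hcol, hcol, inv_mulVec_dotProduct_matRI_mulVec hS hdet,
      row_dotProduct_inv_matS1_mulVec_row hdet hγ, hiso, sub_zero]
  rw [Matrix.det_fin_two]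
  simp only [hentry, r, Matrix.cons_val_zero, Matrix.cons_val_one]
  ring

end forms

/-- **The majorant `R_I` computes the Eisenstein summand at the base point.**
For `γ` orthogonal with respect to `S₁`, with last two rows `lᵗ`, `mᵗ` and
`ℓ = S₁⁻¹·(m | l)`:
(a) `det(ℓᵀ R_I ℓ) = ((l₂+l_{n+3})(m₁+m_{n+4}) − (l₁+l_{n+4})(m₂+m_{n+3}))²`;
(b) `j(γ, I) = (m₁+m_{n+4}) + i(m₂+m_{n+3})` and, when `j(γ, I) ≠ 0`,
`Im((γ⟨I⟩)₂) / Q₀[Im(γ⟨I⟩)] = (l₂+l_{n+3})(m₁+m_{n+4}) − (l₁+l_{n+4})(m₂+m_{n+3})`;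
in particular `(Im((γ⟨I⟩)₂) / Q₀[Im(γ⟨I⟩)])² = det(R_I[ℓ])`. -/
theorem stmt2 (n : ℕ) (hn : 1 ≤ n) (S : Matrix (Fin n) (Fin n) ℤ)
    (hSsymm : S.IsSymm) (hSpos : (S.map (Int.cast : ℤ → ℝ)).PosDef)
    (hSeven : ∀ x : Fin n → ℤ, 2 ∣ x ⬝ᵥ S.mulVec x)
    (γ : Matrix (Fin (n + 4)) (Fin (n + 4)) ℝ)
    (hγ : γᵀ * matS1 n (S.map (Int.cast : ℤ → ℝ)) * γ = matS1 n (S.map (Int.cast : ℤ → ℝ)))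
    (hj : jFactor n (S.map (Int.cast : ℤ → ℝ)) γ ≠ 0)
    (l m : Fin (n + 4) → ℝ)
    (hl : l = γ ⟨n + 2, by omega⟩) (hm : m = γ ⟨n + 3, by omega⟩)
    (E : ℝ)
    (hE : E = (l 1 + l ⟨n + 2, by omega⟩) * (m 0 + m ⟨n + 3, by omega⟩) -
      (l 0 + l ⟨n + 3, by omega⟩) * (m 1 + m ⟨n + 2, by omega⟩)) :
    ((colIso n (S.map (Int.cast : ℤ → ℝ)) γ)ᵀ * matRI n (S.map (Int.cast : ℤ → ℝ)) *
        colIso n (S.map (Int.cast : ℤ → ℝ)) γ).det = E ^ 2 ∧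
    jFactor n (S.map (Int.cast : ℤ → ℝ)) γ =
      ((m 0 + m ⟨n + 3, by omega⟩ : ℝ) : ℂ) +
        Complex.I * ((m 1 + m ⟨n + 2, by omega⟩ : ℝ) : ℂ) ∧
    (actI n (S.map (Int.cast : ℤ → ℝ)) γ ⟨n + 1, by omega⟩).im /
        ((fun k => (actI n (S.map (Int.cast : ℤ → ℝ)) γ k).im) ⬝ᵥ
          (((1 : ℝ) / 2) • matS0 n (S.map (Int.cast : ℤ → ℝ)) *ᵥ
            fun k => (actI n (S.map (Int.cast : ℤ → ℝ)) γ k).im)) = E ∧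
    ((actI n (S.map (Int.cast : ℤ → ℝ)) γ ⟨n + 1, by omega⟩).im /
        ((fun k => (actI n (S.map (Int.cast : ℤ → ℝ)) γ k).im) ⬝ᵥ
          (((1 : ℝ) / 2) • matS0 n (S.map (Int.cast : ℤ → ℝ)) *ᵥ
            fun k => (actI n (S.map (Int.cast : ℤ → ℝ)) γ k).im))) ^ 2 =
      ((colIso n (S.map (Int.cast : ℤ → ℝ)) γ)ᵀ * matRI n (S.map (Int.cast : ℤ → ℝ)) *
        colIso n (S.map (Int.cast : ℤ → ℝ)) γ).det := by
  have hsymm : (S.map (Int.cast : ℤ → ℝ)).IsSymm := hSsymm.map _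
  generalize S.map (Int.cast : ℤ → ℝ) = T at *
  have hdet : IsUnit T.det := hSpos.det_pos.ne'.isUnit
  have ha := det_colIso_gram hsymm hdet hγ
  simp only [dotProduct_outerVec, dotProduct_innerVec, ← hl, ← hm] at ha
  rw [← hE] at ha
  have hp : (γ *ᵥ outerVec n) (Fin.last (n + 3)) = m 0 + m ⟨n + 3, by omega⟩ := by
    rw [hm]; exact dotProduct_outerVec _
  have hq : (γ *ᵥ innerVec n) (Fin.last (n + 3)) = m 1 + m ⟨n + 2, by omega⟩ := by
    rw [hm]; exact dotProduct_innerVec _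
  have hjeq := jFactor_eq (S := T) γ
  rw [hp, hq] at hjeq
  have hpq : (m 0 + m ⟨n + 3, by omega⟩) ^ 2 + (m 1 + m ⟨n + 2, by omega⟩) ^ 2 ≠ 0 := by
    intro h
    obtain ⟨h1, h2⟩ := (add_eq_zero_iff_of_nonneg (sq_nonneg _) (sq_nonneg _)).mp h
    apply hj
    rw [hjeq, pow_eq_zero_iff two_ne_zero |>.mp h1, pow_eq_zero_iff two_ne_zero |>.mp h2]
    simp
  have hlo : (γ *ᵥ outerVec n) (Fin.last (n + 1)).castSucc.succ =
      l 0 + l ⟨n + 3, by omega⟩ := by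
    rw [hl]; exact dotProduct_outerVec _
  have hli : (γ *ᵥ innerVec n) (Fin.last (n + 1)).castSucc.succ =
      l 1 + l ⟨n + 2, by omega⟩ := by
    rw [hl]; exact dotProduct_innerVec _
  have him : (actI n T γ ⟨n + 1, by omega⟩).im =
      E / ((m 0 + m ⟨n + 3, by omega⟩) ^ 2 + (m 1 + m ⟨n + 2, by omega⟩) ^ 2) := by
    have h := actI_eq (S := T) γ (Fin.last (n + 1))
    rw [hlo, hli, hjeq] at h
    rw [hE, ← Complex.im_ofReal_add_I_mul_div, ← h]
    rfl
  have hb : (actI n T γ ⟨n + 1, by omega⟩).im /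
      ((fun k => (actI n T γ k).im) ⬝ᵥ
        (((1 : ℝ) / 2) • matS0 n T *ᵥ fun k => (actI n T γ k).im)) = E := by
    rw [him, Q0_im_actI hsymm hγ hp hq hpq]
    field_simp
  exact ⟨ha, hjeq, hb, by rw [hb, ha]⟩

end
end

section
/- Let R ∈ Mat_{n+4}(ℝ) be symmetric positive definite, and let GL₂(ℤ) act by right multiplication on Mat_{n+4,2}(ℤ). Let Y := {ℓ ∈ Mat_{n+4,2}(ℤ) : rank ℓ = 2 and ℓᵗS₁ℓ = 0} and X := {ℓ ∈ Mat_{n+4,2}(ℤ) : ℓ primitive and ℓᵗS₁ℓ = 0} (primitive meaning ℓ admits a left inverse in Mat_{2,n+4}(ℤ)); both sets are stable under the GL₂(ℤ)-action, and ℓ ↦ det(ℓᵗRℓ) is constant on orbits. Let s ∈ ℝ with s > 2 and suppose the family [ℓ] ↦ det(R[ℓ])^{−s/2} over Y/GL₂(ℤ) is summable. Then the family over X/GL₂(ℤ) is summable and ∑_{[ℓ] ∈ Y/GL₂(ℤ)} det(R[ℓ])^{−s/2} = ζ(s)·ζ(s−1)·∑_{[ℓ] ∈ X/GL₂(ℤ)}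 det(R[ℓ])^{−s/2}, where ζ denotes the Riemann zeta function. -/
open Matrix

noncomputable section

/-- `det(R[ℓ]) = det(ℓᵀ R ℓ)` for an integral `(n+4)×2` matrix `ℓ`. -/
def qd (n : ℕ) (R : Matrix (Fin (n + 4)) (Fin (n + 4)) ℝ)
    (L : Matrix (Fin (n + 4)) (Fin 2) ℤ) : ℝ :=
  ((L.map (Int.cast : ℤ → ℝ))ᵀ * R * L.map (Int.cast : ℤ → ℝ)).det

lemma qd_mulUnit (n : ℕ) (R : Matrix (Fin (n + 4)) (Fin (n + 4)) ℝ)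
    (L : Matrix (Fin (n + 4)) (Fin 2) ℤ) (U : Matrix (Fin 2) (Fin 2) ℤ)
    (hU : IsUnit U.det) : qd n R (L * U) = qd n R L := by
  have hmap : (L * U).map (Int.cast : ℤ → ℝ) =
      L.map (Int.cast : ℤ → ℝ) * U.map (Int.cast : ℤ → ℝ) := by
    ext i j
    simp [Matrix.mul_apply]
  have key : ((L * U).map (Int.cast : ℤ → ℝ))ᵀ * R * ((L * U).map (Int.cast : ℤ → ℝ)) =
      (U.map (Int.cast : ℤ → ℝ))ᵀ *
        ((L.map (Int.cast : ℤ → ℝ))ᵀ * R * (L.map (Int.cast : ℤ → ℝ))) *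
        (U.map (Int.cast : ℤ → ℝ)) := by
    rw [hmap]
    simp only [Matrix.transpose_mul, Matrix.mul_assoc]
  have hdet : (U.map (Int.cast : ℤ → ℝ)).det = ((U.det : ℤ) : ℝ) :=
    (RingHom.map_det (Int.castRingHom ℝ) U).symm
  unfold qd
  rw [key, Matrix.det_mul, Matrix.det_mul, Matrix.det_transpose, hdet]
  rcases Int.isUnit_iff.mp hU with h | h <;> simp [h]

/-- The family `[ℓ] ↦ det(R[ℓ])^{−s/2}` on the orbit space of
`{ℓ : Mat_{n+4,2}(ℤ) // p ℓ}` under the right `GL₂(ℤ)`-action; well defined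
since `det(R[ℓU]) = det(U)²·det(R[ℓ]) = det(R[ℓ])` for `U ∈ GL₂(ℤ)`. -/
def epSummand (n : ℕ) (R : Matrix (Fin (n + 4)) (Fin (n + 4)) ℝ) (s : ℝ)
    (p : Matrix (Fin (n + 4)) (Fin 2) ℤ → Prop) :
    Quot (fun a b : {ℓ : Matrix (Fin (n + 4)) (Fin 2) ℤ // p ℓ} =>
      ∃ U : Matrix (Fin 2) (Fin 2) ℤ, IsUnit U.det ∧ b.val = a.val * U) → ℝ :=
  Quot.lift (fun a => qd n R a.val ^ (-(s / 2))) (by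
    rintro a b ⟨U, hU, h⟩
    simp only [h, qd_mulUnit n R a.val U hU])

/-- `ℓ` has rank `2` and is isotropic: `ℓᵀ S₁ ℓ = 0`. -/
def rank2Iso (n : ℕ) (S : Matrix (Fin n) (Fin n) ℝ)
    (ℓ : Matrix (Fin (n + 4)) (Fin 2) ℤ) : Prop :=
  (ℓ.map (Int.cast : ℤ → ℚ)).rank = 2 ∧
    (ℓ.map (Int.cast : ℤ → ℝ))ᵀ * matS1 n S * ℓ.map (Int.cast : ℤ → ℝ) = 0

/-- `ℓ` is primitive (admits an integral left inverse) and isotropic. -/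
def primIso (n : ℕ) (S : Matrix (Fin n) (Fin n) ℝ)
    (ℓ : Matrix (Fin (n + 4)) (Fin 2) ℤ) : Prop :=
  (∃ A : Matrix (Fin 2) (Fin (n + 4)) ℤ, A * ℓ = 1) ∧
    (ℓ.map (Int.cast : ℤ → ℝ))ᵀ * matS1 n S * ℓ.map (Int.cast : ℤ → ℝ) = 0

/-- Casting entries commutes with products of integral matrices. -/
lemma map_intCast_mul {κ μ ν : Type*} [Fintype μ] (K : Type*) [CommRing K]
    (A : Matrix κ μ ℤ) (B : Matrix μ ν ℤ) :
    (A * B).map (Int.cast : ℤ → K) = A.map (Int.cast : ℤ → K) * B.map (Int.cast : ℤ → K) :=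
  Matrix.map_mul (f := Int.castRingHom K)

lemma det_map_intCast (K : Type*) [CommRing K] (M : Matrix (Fin 2) (Fin 2) ℤ) :
    (M.map (Int.cast : ℤ → K)).det = (M.det : K) :=
  (RingHom.map_det (Int.castRingHom K) M).symm

/-- An integral matrix of rank two factors through a primitive one. -/
lemma exists_primitive_factorization {ι : Type*} [Fintype ι] [DecidableEq ι]
    (L : Matrix ι (Fin 2) ℤ)
    (hL : (L.map (Int.cast : ℤ → ℚ)).rank = 2) :
    ∃ (P : Matrix ι (Fin 2) ℤ) (A : Matrix (Fin 2) ι ℤ) (M : Matrix (Fin 2) (Fin 2) ℤ),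
      A * P = 1 ∧ L = P * M ∧ M.det ≠ 0 := by
  obtain ⟨k, snf⟩ := Submodule.smithNormalForm (Pi.basisFun ℤ ι) (LinearMap.range L.mulVecLin)
  let P : Matrix ι (Fin k) ℤ := Matrix.of fun i j => snf.bM (snf.f j) i
  let A : Matrix (Fin k) ι ℤ := Matrix.of fun j i => snf.bM.repr (Pi.single i 1) (snf.f j)
  let c : Fin 2 → LinearMap.range L.mulVecLin := fun j => ⟨L.mulVecLin (Pi.single j 1), ⟨_, rfl⟩⟩
  let M : Matrix (Fin k) (Fin 2) ℤ := Matrix.of fun i j => snf.bN.repr (c j) i * snf.a i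
  have hAP : A * P = 1 := by
    ext j j'
    have hv : ∑ i, snf.bM (snf.f j') i • (Pi.single i 1 : ι → ℤ) = snf.bM (snf.f j') := by
      ext x
      simp [Finset.sum_apply, Pi.single_apply]
    have h := congrArg (fun v => snf.bM.repr v (snf.f j)) hv
    simp only [map_sum, map_smul, Finsupp.coe_finsetSum, Finset.sum_apply, Finsupp.smul_apply,
      Module.Basis.repr_self, smul_eq_mul] at h
    rw [Matrix.mul_apply, Matrix.one_apply]
    simp only [A, P, Matrix.of_apply]
    rw [Finset.sum_congr rfl fun i _ => mul_comm _ _, h, Finsupp.single_apply]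
    simp [eq_comm]
  have hLPM : L = P * M := by
    ext i j
    have h := congrArg (fun v : LinearMap.range L.mulVecLin => (v : ι → ℤ) i)
      (snf.bN.sum_repr (c j))
    simp only [Submodule.coe_sum, Submodule.coe_smul, Finset.sum_apply, Pi.smul_apply, snf.snf,
      smul_eq_mul] at h
    have hc : (c j : ι → ℤ) i = L i j := by simp [c]
    rw [← hc, ← h, Matrix.mul_apply]
    exact Finset.sum_congr rfl fun x _ => by simp only [P, M, Matrix.of_apply]; ring
  have hk : k = 2 := by
    apply le_antisymm
    · have h := LinearMap.finrank_range_le L.mulVecLin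
      rw [Module.finrank_eq_card_basis snf.bN] at h
      simpa using h
    · rw [← hL, hLPM, map_intCast_mul]
      exact (Matrix.rank_mul_le_left _ _).trans
        (by simpa using Matrix.rank_le_card_width (P.map (Int.cast : ℤ → ℚ)))
  subst hk
  refine ⟨P, A, M, hAP, hLPM, fun hM => ?_⟩
  have hr : (M.map (Int.cast : ℤ → ℚ)).rank = 2 := by
    apply le_antisymm (by simpa using Matrix.rank_le_width _)
    refine hL.symm.le.trans ?_
    rw [hLPM, map_intCast_mul]
    exact Matrix.rank_mul_le_right _ _
  have hli : LinearIndependent ℚ (M.map (Int.cast : ℤ → ℚ)).col := by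
    rw [linearIndependent_iff_card_eq_finrank_span, Set.finrank,
      ← Matrix.rank_eq_finrank_span_cols, hr]
    simp
  have hu := (Matrix.isUnit_iff_isUnit_det _).mp (Matrix.linearIndependent_cols_iff_isUnit.mp hli)
  rw [det_map_intCast, hM] at hu
  simp at hu

/-- Indices of the `2 × 2` Hermite normal forms: diagonal `(a, d)` and a residue modulo `d`. -/
abbrev HermiteIndex := Σ p : ℕ+ × ℕ+, Fin p.2

/-- The nonsingular lower triangular matrix in Hermite normal form with a given index. -/
def hermiteForm (h : HermiteIndex) : Matrix (Fin 2) (Fin 2) ℤ :=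
  !![((h.1.1 : ℕ) : ℤ), 0; ((h.2 : ℕ) : ℤ), ((h.1.2 : ℕ) : ℤ)]

lemma det_hermiteForm (h : HermiteIndex) :
    (hermiteForm h).det = ((h.1.1 : ℕ) : ℤ) * ((h.1.2 : ℕ) : ℤ) := by
  simp [hermiteForm, Matrix.det_fin_two]

lemma det_hermiteForm_ne_zero (h : HermiteIndex) : (hermiteForm h).det ≠ 0 := by
  rw [det_hermiteForm]
  have := h.1.1.pos
  have := h.1.2.pos
  positivity

/-- A nonsingular lower triangular matrix can be brought into Hermite normal form. -/
lemma exists_hermiteForm_of_lower (a b d : ℤ) (ha : 0 < a) (hd : d ≠ 0) :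
    ∃ (U : Matrix (Fin 2) (Fin 2) ℤ) (h : HermiteIndex),
      IsUnit U.det ∧ !![a, 0; b, d] * U = hermiteForm h := by
  have hlt : b % d < (d.natAbs : ℤ) := by simpa using Int.emod_lt_abs b hd
  have hnn := Int.emod_nonneg b hd
  refine ⟨!![1, 0; -(b / d), d.sign],
    ⟨(⟨a.toNat, by omega⟩, ⟨d.natAbs, by omega⟩), ⟨(b % d).toNat, ?_⟩⟩, ?_, ?_⟩
  · simp only [PNat.mk_coe]
    omega
  · rw [Matrix.det_fin_two_of, one_mul, zero_mul, sub_zero]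
    rcases lt_or_gt_of_ne hd with h | h
    · exact Int.isUnit_iff.mpr (Or.inr (Int.sign_eq_neg_one_of_neg h))
    · exact Int.isUnit_iff.mpr (Or.inl (Int.sign_eq_one_of_pos h))
  · have h1 := Int.emod_add_mul_ediv b d
    have h2 : d * d.sign = |d| := by rw [Int.mul_sign_self, Int.natCast_natAbs]
    ext i j
    fin_cases i <;> fin_cases j <;>
      simp [hermiteForm, Matrix.mul_apply, Fin.sum_univ_two, hnn, ha.le, h2]
    linarith

/-- Every nonsingular `2 × 2` integral matrix has a Hermite normal form. -/
lemma exists_hermiteForm (M : Matrix (Fin 2) (Fin 2) ℤ) (hM : M.det ≠ 0) :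
    ∃ (U : Matrix (Fin 2) (Fin 2) ℤ) (h : HermiteIndex),
      IsUnit U.det ∧ M * U = hermiteForm h := by
  rw [Matrix.det_fin_two] at hM
  set x := M 0 0 with hx
  set y := M 0 1 with hy
  have hg : (0 : ℤ) < Int.gcd x y := by
    have : Int.gcd x y ≠ 0 := fun h => by
      obtain ⟨h1, h2⟩ := Int.gcd_eq_zero_iff.mp h
      simp [h1, h2] at hM
    omega
  obtain ⟨x', hx'⟩ := Int.gcd_dvd_left x y
  obtain ⟨y', hy'⟩ := Int.gcd_dvd_right x y
  have hbez := Int.gcd_eq_gcd_ab x y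
  set g : ℤ := (Int.gcd x y : ℤ)
  set u := Int.gcdA x y
  set v := Int.gcdB x y
  have hdet : x' * u + y' * v = 1 := by
    apply mul_left_cancel₀ hg.ne'
    linear_combination -hbez - u * hx' - v * hy'
  let V : Matrix (Fin 2) (Fin 2) ℤ := !![u, -y'; v, x']
  have hV : V.det = 1 := by
    simp only [V, Matrix.det_fin_two_of]
    linarith
  have hMV : M * V = !![g, 0; M 1 0 * u + M 1 1 * v, M 1 1 * x' - M 1 0 * y'] := by
    ext i j
    fin_cases i <;> fin_cases j <;>
      simp [V, Matrix.mul_apply, Fin.sum_univ_two, ← hx, ← hy]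
    · linarith
    · linear_combination y' * (-hx') + x' * hy'
    · ring
  have hd : M 1 1 * x' - M 1 0 * y' ≠ 0 := fun h => hM (by
    linear_combination M 1 1 * hx' - M 1 0 * hy' + g * h)
  obtain ⟨W, h, hW, hh⟩ := exists_hermiteForm_of_lower g (M 1 0 * u + M 1 1 * v) _ hg hd
  refine ⟨V * W, h, ?_, ?_⟩
  · rw [Matrix.det_mul, hV, one_mul]
    exact hW
  · rw [← Matrix.mul_assoc, hMV, hh]

/-- Hermite normal forms in the same right `GL₂(ℤ)`-orbit are equal. -/
lemma hermiteForm_injective {h h' : HermiteIndex} {U : Matrix (Fin 2) (Fin 2) ℤ}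
    (hU : IsUnit U.det) (hh : hermiteForm h' = hermiteForm h * U) : h = h' := by
  obtain ⟨⟨a, d⟩, b⟩ := h
  obtain ⟨⟨a', d'⟩, b'⟩ := h'
  have e00 := congrFun (congrFun hh 0) 0
  have e01 := congrFun (congrFun hh 0) 1
  have e10 := congrFun (congrFun hh 1) 0
  have e11 := congrFun (congrFun hh 1) 1
  simp [hermiteForm, Matrix.mul_apply, Fin.sum_univ_two] at e00 e01 e10 e11
  rw [e01, mul_zero, zero_add] at e11
  rw [Matrix.det_fin_two, e01, zero_mul, sub_zero, Int.isUnit_iff] at hU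
  have ha : (0 : ℤ) < (a : ℕ) := by exact_mod_cast a.pos
  have ha' : (0 : ℤ) < (a' : ℕ) := by exact_mod_cast a'.pos
  have hd : (0 : ℤ) < (d : ℕ) := by exact_mod_cast d.pos
  have hd' : (0 : ℤ) < (d' : ℕ) := by exact_mod_cast d'.pos
  have hx : 0 < U 0 0 := pos_of_mul_pos_right (e00 ▸ ha') ha.le
  have hw : 0 < U 1 1 := pos_of_mul_pos_right (e11 ▸ hd') hd.le
  have hxw : U 0 0 * U 1 1 = 1 := by
    rcases hU with h | h
    · exact h
    · nlinarith
  have hx1 : U 0 0 = 1 := by nlinarith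
  have hw1 : U 1 1 = 1 := by nlinarith
  rw [hx1, mul_one] at e00 e10
  rw [hw1, mul_one] at e11
  obtain rfl : a = a' := PNat.eq (by exact_mod_cast e00.symm)
  obtain rfl : d = d' := PNat.eq (by exact_mod_cast e11.symm)
  have hb : ((b : ℕ) : ℤ) < (d : ℕ) := by exact_mod_cast b.isLt
  have hb' : ((b' : ℕ) : ℤ) < (d : ℕ) := by exact_mod_cast b'.isLt
  have hb0 : (0 : ℤ) ≤ ((b : ℕ) : ℤ) := by positivity
  have hb0' : (0 : ℤ) ≤ ((b' : ℕ) : ℤ) := by positivity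
  have hz1 : U 1 0 < 1 := by nlinarith
  have hz2 : -1 < U 1 0 := by nlinarith
  have hz : U 1 0 = 0 := by omega
  rw [hz, mul_zero, add_zero] at e10
  obtain rfl : b = b' := Fin.ext (by exact_mod_cast e10.symm)
  rfl

/-- Nonsingular square integral matrices can be cancelled on the right. -/
lemma mul_right_cancel_of_det_ne_zero {κ : Type*} {M : Matrix (Fin 2) (Fin 2) ℤ} (hM : M.det ≠ 0)
    {P Q : Matrix κ (Fin 2) ℤ} (h : P * M = Q * M) : P = Q := by
  have h' := congrArg (· * M.adjugate) h
  simp only [Matrix.mul_assoc, Matrix.mul_adjugate, Matrix.mul_smul, Matrix.mul_one] at h'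
  ext i j
  exact mul_left_cancel₀ hM (congrFun (congrFun h' i) j)

/-- Primitive matrices generating commensurable lattices lie in one `GL₂(ℤ)`-orbit. -/
lemma exists_unit_of_mul_eq_mul {ι : Type*} [Fintype ι] {P Q : Matrix ι (Fin 2) ℤ}
    {A B : Matrix (Fin 2) ι ℤ}
    (hA : A * P = 1) (hB : B * Q = 1) {M N : Matrix (Fin 2) (Fin 2) ℤ}
    (hM : M.det ≠ 0) (hN : N.det ≠ 0) (h : P * M = Q * N) :
    ∃ U : Matrix (Fin 2) (Fin 2) ℤ, IsUnit U.det ∧ Q = P * U := by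
  have hQ : Q = P * (A * Q) := mul_right_cancel_of_det_ne_zero hN (by
    rw [← Matrix.mul_assoc P, Matrix.mul_assoc (P * A), ← h, ← Matrix.mul_assoc (P * A),
      Matrix.mul_assoc P, hA, Matrix.mul_one])
  have hP : P = Q * (B * P) := mul_right_cancel_of_det_ne_zero hM (by
    rw [← Matrix.mul_assoc Q, Matrix.mul_assoc (Q * B), h, ← Matrix.mul_assoc (Q * B),
      Matrix.mul_assoc Q, hB, Matrix.mul_one])
  refine ⟨A * Q, ?_, hQ⟩
  have h1 : (B * P) * (A * Q) = 1 := by rw [Matrix.mul_assoc, ← hQ, hB]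
  have h2 := congrArg Matrix.det h1
  rw [Matrix.det_mul, Matrix.det_one] at h2
  exact IsUnit.of_mul_eq_one_right _ h2

/-- Right `GL₂(ℤ)`-equivalence on a set of integral matrices. -/
lemma equivalence_mulUnit {κ : Type*} (p : Matrix κ (Fin 2) ℤ → Prop) :
    Equivalence (fun a b : {L : Matrix κ (Fin 2) ℤ // p L} =>
      ∃ U : Matrix (Fin 2) (Fin 2) ℤ, IsUnit U.det ∧ b.val = a.val * U) where
  refl a := ⟨1, by simp, by simp⟩
  symm := by
    rintro a b ⟨U, hU, h⟩
    refine ⟨U⁻¹, Matrix.isUnit_nonsing_inv_det U hU, ?_⟩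
    rw [h, Matrix.mul_assoc, Matrix.mul_nonsing_inv U hU, Matrix.mul_one]
  trans := by
    rintro a b c ⟨U, hU, h⟩ ⟨V, hV, h'⟩
    exact ⟨U * V, by rw [Matrix.det_mul]; exact hU.mul hV, by rw [h', h, Matrix.mul_assoc]⟩

lemma congruence_mul {κ : Type*} [Fintype κ] (T : Matrix κ κ ℝ) (P : Matrix κ (Fin 2) ℤ)
    (M : Matrix (Fin 2) (Fin 2) ℤ) :
    ((P * M).map (Int.cast : ℤ → ℝ))ᵀ * T * (P * M).map (Int.cast : ℤ → ℝ) =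
      (M.map (Int.cast : ℤ → ℝ))ᵀ *
        ((P.map (Int.cast : ℤ → ℝ))ᵀ * T * P.map (Int.cast : ℤ → ℝ)) *
        M.map (Int.cast : ℤ → ℝ) := by
  rw [map_intCast_mul]
  simp only [Matrix.transpose_mul, Matrix.mul_assoc]

/-- Isotropy descends along multiplication by a nonsingular matrix. -/
lemma isotropic_of_mul {κ : Type*} [Fintype κ] (T : Matrix κ κ ℝ) (P : Matrix κ (Fin 2) ℤ)
    {M : Matrix (Fin 2) (Fin 2) ℤ} (hM : M.det ≠ 0)
    (h : ((P * M).map (Int.cast : ℤ → ℝ))ᵀ * T * (P * M).map (Int.cast : ℤ → ℝ) = 0) :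
    (P.map (Int.cast : ℤ → ℝ))ᵀ * T * P.map (Int.cast : ℤ → ℝ) = 0 := by
  rw [congruence_mul] at h
  have hu : IsUnit (M.map (Int.cast : ℤ → ℝ)) := by
    rw [Matrix.isUnit_iff_isUnit_det, det_map_intCast]
    exact (Int.cast_ne_zero.mpr hM).isUnit
  have hut : IsUnit (M.map (Int.cast : ℤ → ℝ))ᵀ := by
    rw [Matrix.isUnit_iff_isUnit_det, Matrix.det_transpose, ← Matrix.isUnit_iff_isUnit_det]
    exact hu
  exact hut.mul_right_eq_zero.mp (hu.mul_left_eq_zero.mp h)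

lemma rank2Iso_mul {n : ℕ} {S : Matrix (Fin n) (Fin n) ℝ} {P : Matrix (Fin (n + 4)) (Fin 2) ℤ}
    (hP : primIso n S P) {M : Matrix (Fin 2) (Fin 2) ℤ} (hM : M.det ≠ 0) :
    rank2Iso n S (P * M) := by
  obtain ⟨⟨A, hA⟩, hiso⟩ := hP
  refine ⟨?_, by rw [congruence_mul, hiso, Matrix.mul_zero, Matrix.zero_mul]⟩
  apply le_antisymm (by simpa using Matrix.rank_le_width _)
  have hu : IsUnit (M.map (Int.cast : ℤ → ℚ)) := by
    rw [Matrix.isUnit_iff_isUnit_det, det_map_intCast]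
    exact (Int.cast_ne_zero.mpr hM).isUnit
  have hr : (M.map (Int.cast : ℤ → ℚ)).rank = 2 := by simpa using Matrix.rank_of_isUnit _ hu
  calc 2 = ((A * (P * M)).map (Int.cast : ℤ → ℚ)).rank := by
        rw [← Matrix.mul_assoc, hA, Matrix.one_mul, hr]
    _ ≤ _ := by
        rw [map_intCast_mul]
        exact Matrix.rank_mul_le_right _ _

/-- The orbit space of integral matrices satisfying `p` under right multiplication by
`GL₂(ℤ)`. -/
abbrev OrbitSpace (n : ℕ) (p : Matrix (Fin (n + 4)) (Fin 2) ℤ → Prop) :=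
  Quot (fun a b : {ℓ : Matrix (Fin (n + 4)) (Fin 2) ℤ // p ℓ} =>
      ∃ U : Matrix (Fin 2) (Fin 2) ℤ, IsUnit U.det ∧ b.val = a.val * U)

/-- Multiply a chosen representative of a primitive orbit by a Hermite normal form. -/
def orbitMul (n : ℕ) (S : Matrix (Fin n) (Fin n) ℝ)
    (x : OrbitSpace n (primIso n S) × HermiteIndex) : OrbitSpace n (rank2Iso n S) :=
  Quot.mk _ ⟨x.1.out.val * hermiteForm x.2,
    rank2Iso_mul x.1.out.property (det_hermiteForm_ne_zero x.2)⟩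

lemma orbitMul_bijective (n : ℕ) (S : Matrix (Fin n) (Fin n) ℝ) :
    Function.Bijective (orbitMul n S) := by
  constructor
  · rintro ⟨q, h⟩ ⟨q', h'⟩ heq
    obtain ⟨U, hU, hUeq⟩ := ((equivalence_mulUnit _).quot_mk_eq_iff _ _).mp heq
    dsimp only at hUeq
    obtain ⟨A, hA⟩ := q.out.property.1
    obtain ⟨B, hB⟩ := q'.out.property.1
    rw [Matrix.mul_assoc] at hUeq
    have hMU : (hermiteForm h * U).det ≠ 0 := by
      rw [Matrix.det_mul]
      exact mul_ne_zero (det_hermiteForm_ne_zero h) hU.ne_zero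
    obtain rfl : q = q' := by
      rw [← q.out_eq, ← q'.out_eq]
      exact Quot.sound
        (exists_unit_of_mul_eq_mul hA hB hMU (det_hermiteForm_ne_zero h') hUeq.symm)
    have hh := congrArg (A * ·) hUeq
    simp only [← Matrix.mul_assoc, hA, Matrix.one_mul] at hh
    rw [hermiteForm_injective hU hh]
  · intro y
    induction y using Quot.ind with
    | mk L =>
      obtain ⟨L, hL⟩ := L
      obtain ⟨P, A, M, hA, rfl, hM⟩ := exists_primitive_factorization L hL.1
      have hP : primIso n S P := ⟨⟨A, hA⟩, isotropic_of_mul _ P hM hL.2⟩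
      let q : OrbitSpace n (primIso n S) := Quot.mk _ ⟨P, hP⟩
      obtain ⟨V, hV, hPV⟩ := ((equivalence_mulUnit _).quot_mk_eq_iff _ _).mp q.out_eq
      dsimp only at hPV
      have hVM : (V * M).det ≠ 0 := by
        rw [Matrix.det_mul]
        exact mul_ne_zero hV.ne_zero hM
      obtain ⟨U, h, hU, hUh⟩ := exists_hermiteForm (V * M) hVM
      refine ⟨(q, h), ((equivalence_mulUnit _).quot_mk_eq_iff _ _).mpr
        ((equivalence_mulUnit _).symm ⟨U, hU, ?_⟩)⟩
      dsimp only
      rw [← hUh, hPV]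
      simp only [Matrix.mul_assoc]

lemma qd_mul (n : ℕ) (R : Matrix (Fin (n + 4)) (Fin (n + 4)) ℝ)
    (P : Matrix (Fin (n + 4)) (Fin 2) ℤ) (M : Matrix (Fin 2) (Fin 2) ℤ) :
    qd n R (P * M) = (M.det : ℝ) ^ 2 * qd n R P := by
  unfold qd
  rw [congruence_mul, Matrix.det_mul, Matrix.det_mul, Matrix.det_transpose, det_map_intCast]
  ring

lemma qd_nonneg {n : ℕ} {R : Matrix (Fin (n + 4)) (Fin (n + 4)) ℝ} (hR : R.PosDef)
    (P : Matrix (Fin (n + 4)) (Fin 2) ℤ) : 0 ≤ qd n R P := by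
  have h := (hR.posSemidef.conjTranspose_mul_mul_same (P.map (Int.cast : ℤ → ℝ))).det_nonneg
  rwa [Matrix.conjTranspose_eq_transpose_of_trivial] at h

/-- The contribution `(ad)⁻ˢ` of a Hermite normal form. -/
def hermiteWeight (s : ℝ) (h : HermiteIndex) : ℝ :=
  ((h.1.1 : ℕ) : ℝ) ^ (-s) * ((h.1.2 : ℕ) : ℝ) ^ (-s)

lemma epSummand_orbitMul {n : ℕ} {R : Matrix (Fin (n + 4)) (Fin (n + 4)) ℝ} (hR : R.PosDef)
    (s : ℝ) (S : Matrix (Fin n) (Fin n) ℝ) (x : OrbitSpace n (primIso n S) × HermiteIndex) :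
    epSummand n R s (rank2Iso n S) (orbitMul n S x) =
      epSummand n R s (primIso n S) x.1 * hermiteWeight s x.2 := by
  obtain ⟨q, h⟩ := x
  have hq : epSummand n R s (primIso n S) q = qd n R q.out.val ^ (-(s / 2)) := by
    conv_lhs => rw [← q.out_eq]
    rfl
  have hy : epSummand n R s (rank2Iso n S) (orbitMul n S (q, h)) =
      qd n R (q.out.val * hermiteForm h) ^ (-(s / 2)) := rfl
  rw [hq, hy, qd_mul, det_hermiteForm, Real.mul_rpow (sq_nonneg _) (qd_nonneg hR _), mul_comm,
    hermiteWeight, ← Real.mul_rpow (Nat.cast_nonneg (h.1.1 : ℕ)) (Nat.cast_nonneg (h.1.2 : ℕ)),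
    ← Real.rpow_natCast]
  push_cast
  rw [← Real.rpow_mul (by positivity)]
  congr 2
  ring

/-- The sum of `k⁻ˢ` over positive integers is `ζ(s)`, as a real series. -/
lemma summable_and_tsum_pnat_rpow_neg {s : ℝ} (hs : 1 < s) :
    Summable (fun k : ℕ+ => ((k : ℕ) : ℝ) ^ (-s)) ∧
      ((∑' k : ℕ+, ((k : ℕ) : ℝ) ^ (-s) : ℝ) : ℂ) = riemannZeta (s : ℂ) := by
  constructor
  · exact (Real.summable_nat_rpow.mpr (by linarith : -s < -1)).comp_injective PNat.coe_injective
  · rw [tsum_pnat_eq_tsum_succ (f := fun k : ℕ => (k : ℝ) ^ (-s)),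
      zeta_eq_tsum_one_div_nat_add_one_cpow (by simpa using hs), Complex.ofReal_tsum]
    refine tsum_congr fun k => ?_
    rw [Complex.ofReal_cpow (by positivity), Complex.ofReal_neg, Complex.cpow_neg]
    push_cast
    rw [one_div]

lemma hermiteWeight_nonneg (s : ℝ) (h : HermiteIndex) : 0 ≤ hermiteWeight s h := by
  unfold hermiteWeight
  positivity

/-- The Hermite normal forms contribute `ζ(s) ζ(s - 1)`. -/
lemma summable_and_tsum_hermiteWeight {s : ℝ} (hs : 2 < s) :
    Summable (hermiteWeight s) ∧
      ((∑' h, hermiteWeight s h : ℝ) : ℂ) = riemannZeta (s : ℂ) * riemannZeta ((s : ℂ) - 1) := by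
  obtain ⟨h1, e1⟩ := summable_and_tsum_pnat_rpow_neg (by linarith : 1 < s)
  obtain ⟨h2, e2⟩ := summable_and_tsum_pnat_rpow_neg (by linarith : 1 < s - 1)
  have hfib : ∀ p : ℕ+ × ℕ+, ∑' b : Fin p.2, hermiteWeight s ⟨p, b⟩ =
      ((p.1 : ℕ) : ℝ) ^ (-s) * ((p.2 : ℕ) : ℝ) ^ (-(s - 1)) := by
    intro p
    have hp : (0 : ℝ) < ((p.2 : ℕ) : ℝ) := by exact_mod_cast p.2.pos
    rw [tsum_fintype]
    simp only [hermiteWeight, Finset.sum_const, Finset.card_univ, Fintype.card_fin, nsmul_eq_mul]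
    rw [show -(s - 1) = 1 + -s by ring, Real.rpow_add hp, Real.rpow_one]
    ring
  have hprod := h1.mul_of_nonneg h2 (fun _ => by positivity) (fun _ => by positivity)
  have hsum : Summable (hermiteWeight s) := by
    rw [summable_sigma_of_nonneg (hermiteWeight_nonneg s)]
    refine ⟨fun _ => (hasSum_fintype _).summable, ?_⟩
    simpa only [hfib] using hprod
  refine ⟨hsum, ?_⟩
  rw [hsum.tsum_sigma]
  simp only [hfib]
  rw [← h1.tsum_mul_tsum h2 hprod, Complex.ofReal_mul, e1, e2]
  push_cast
  rfl

/-- **Removing the primitivity condition costs `ζ(s)ζ(s−1)`.**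
For `R` symmetric positive definite and `s > 2`, if the Epstein-type family over the
orbit space of rank-2 isotropic matrices is summable, then so is the one over
primitive isotropic matrices, and
`∑_{[ℓ] ∈ Y/GL₂(ℤ)} det(R[ℓ])^{−s/2} = ζ(s)·ζ(s−1)·∑_{[ℓ] ∈ X/GL₂(ℤ)} det(R[ℓ])^{−s/2}`. -/
theorem stmt9 (n : ℕ) (hn : 1 ≤ n) (S : Matrix (Fin n) (Fin n) ℤ)
    (hSsymm : S.IsSymm) (hSpos : (S.map (Int.cast : ℤ → ℝ)).PosDef)
    (hSeven : ∀ x : Fin n → ℤ, 2 ∣ x ⬝ᵥ S.mulVec x)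
    (R : Matrix (Fin (n + 4)) (Fin (n + 4)) ℝ) (hRsymm : R.IsSymm) (hRpos : R.PosDef)
    (s : ℝ) (hs : 2 < s)
    (hsum : Summable (epSummand n R s (rank2Iso n (S.map (Int.cast : ℤ → ℝ))))) :
    Summable (epSummand n R s (primIso n (S.map (Int.cast : ℤ → ℝ)))) ∧
    ((∑' q, epSummand n R s (rank2Iso n (S.map (Int.cast : ℤ → ℝ))) q : ℝ) : ℂ) =
      riemannZeta (s : ℂ) * riemannZeta ((s : ℂ) - 1) *
        ((∑' q, epSummand n R s (primIso n (S.map (Int.cast : ℤ → ℝ))) q : ℝ) : ℂ) := by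
  have hfactor : Summable fun x : OrbitSpace n (primIso n (S.map (Int.cast : ℤ → ℝ))) ×
      HermiteIndex => epSummand n R s _ x.1 * hermiteWeight s x.2 := by
    simpa only [Function.comp_def, epSummand_orbitMul hRpos] using
      hsum.comp_injective (orbitMul_bijective n (S.map (Int.cast : ℤ → ℝ))).injective
  obtain ⟨hw, hζ⟩ := summable_and_tsum_hermiteWeight hs
  have hprim : Summable (epSummand n R s (primIso n (S.map (Int.cast : ℤ → ℝ)))) := by
    have h := hfactor.comp_injective (Prod.mk_left_injective (⟨(1, 1), 0⟩ : HermiteIndex))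
    simpa [Function.comp_def, hermiteWeight] using h
  refine ⟨hprim, ?_⟩
  rw [← (Equiv.ofBijective _ (orbitMul_bijective n (S.map (Int.cast : ℤ → ℝ)))).tsum_eq]
  simp only [Equiv.ofBijective_apply, epSummand_orbitMul hRpos]
  rw [← hprim.tsum_mul_tsum hw hfactor, Complex.ofReal_mul, hζ, mul_comm]

end
end
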